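/- arXiv:2401.06736 — 2 statements merged into one kernel-verified Lean document; each statement's English description precedes it below -/
import Mathlib

section
/- Let α > 0 and suppose Q = m + (α+1)k > 1. Then the function u(z,σ) = log ρ(z,σ) satisfies 𝓛_{α,Q}(u) = 0 at every point of ℝ^N ∖ {(0,0)}. -/
open Real MeasureTheory
open scoped RealInnerProductSpace

noncomputable section

abbrev Euc (n : ℕ) := EuclideanSpace ℝ (Fin n)

/-- A Minkowski norm on `ℝⁿ`: nonnegative, absolutely homogeneous, with `N²` of class `C²`
away from the origin and strictly convex. -/
def IsMinkowskiNorm {n : ℕ} (N : Euc n → ℝ) : Prop :=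
  (∀ x, 0 ≤ N x) ∧ (∀ (l : ℝ) (x : Euc n), N (l • x) = |l| * N x) ∧
  ContDiffOn ℝ 2 (fun x => (N x) ^ 2) {(0 : Euc n)}ᶜ ∧
  StrictConvexOn ℝ Set.univ (fun x => (N x) ^ 2)

/-- The Legendre transform (dual norm) `N⁰(x) = sup { ⟨x,ξ⟩ : N(ξ) = 1 }`. -/
def dualNorm {n : ℕ} (N : Euc n → ℝ) (x : Euc n) : ℝ :=
  sSup ((fun ξ => ⟪x, ξ⟫) '' {ξ | N ξ = 1})

variable {m k : ℕ}

/-- The dual anisotropic Minkowski gauge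
`ρ(z,σ) = (Φ⁰(z)^{2(α+1)} + 4(α+1)²Ψ⁰(σ)²)^{1/(2(α+1))}`. -/
def rho (α : ℝ) (Φ : Euc m → ℝ) (Ψ : Euc k → ℝ) (x : Euc m × Euc k) : ℝ :=
  (dualNorm Φ x.1 ^ (2 * (α + 1)) + 4 * (α + 1) ^ 2 * dualNorm Ψ x.2 ^ 2) ^ (1 / (2 * (α + 1)))

/-- Gradient in the `z` variables. -/
def gradZ (u : Euc m × Euc k → ℝ) (x : Euc m × Euc k) : Euc m :=
  gradient (fun z => u (z, x.2)) x.1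

/-- Gradient in the `σ` variables. -/
def gradS (u : Euc m × Euc k → ℝ) (x : Euc m × Euc k) : Euc k :=
  gradient (fun σ => u (x.1, σ)) x.2

/-- Divergence in the `z` variables. -/
def divZ (V : Euc m × Euc k → Euc m) (x : Euc m × Euc k) : ℝ :=
  ∑ i, fderiv ℝ (fun z => V (z, x.2) i) x.1 (EuclideanSpace.single i 1)

/-- Divergence in the `σ` variables. -/
def divS (V : Euc m × Euc k → Euc k) (x : Euc m × Euc k) : ℝ :=
  ∑ i, fderiv ℝ (fun σ => V (x.1, σ) i) x.2 (EuclideanSpace.single i 1)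

/-- The Finsler Laplacian in the `z` variables, `Δ_Φ(u) = div_z(Φ(∇_z u) ∇Φ(∇_z u))`. -/
def finslerLapZ (Φ : Euc m → ℝ) (u : Euc m × Euc k → ℝ) (x : Euc m × Euc k) : ℝ :=
  divZ (fun y => Φ (gradZ u y) • gradient Φ (gradZ u y)) x

/-- The Finsler Laplacian in the `σ` variables, `Δ_Ψ(u) = div_σ(Ψ(∇_σ u) ∇Ψ(∇_σ u))`. -/
def finslerLapS (Ψ : Euc k → ℝ) (u : Euc m × Euc k → ℝ) (x : Euc m × Euc k) : ℝ :=
  divS (fun y => Ψ (gradS u y) • gradient Ψ (gradS u y)) x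

/-- The operator `𝓛_{α,p}`. -/
def Lop (α p : ℝ) (Φ : Euc m → ℝ) (Ψ : Euc k → ℝ) (u : Euc m × Euc k → ℝ)
    (x : Euc m × Euc k) : ℝ :=
  divZ (fun y =>
      (Φ (gradZ u y) ^ 2 + dualNorm Φ y.1 ^ (2 * α) / 4 * Ψ (gradS u y) ^ 2) ^ ((p - 2) / 2) •
        (Φ (gradZ u y) • gradient Φ (gradZ u y))) x
  + divS (fun y =>
      (Φ (gradZ u y) ^ 2 + dualNorm Φ y.1 ^ (2 * α) / 4 * Ψ (gradS u y) ^ 2) ^ ((p - 2) / 2) •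
        ((dualNorm Φ y.1 ^ (2 * α) / 4 * Ψ (gradS u y)) • gradient Ψ (gradS u y))) x

/-- The operator `𝓛_{α,2}(u) = Δ_Φ(u) + (Φ⁰(z)^{2α}/4) Δ_Ψ(u)`. -/
def Lop2 (α : ℝ) (Φ : Euc m → ℝ) (Ψ : Euc k → ℝ) (u : Euc m × Euc k → ℝ)
    (x : Euc m × Euc k) : ℝ :=
  finslerLapZ Φ u x + dualNorm Φ x.1 ^ (2 * α) / 4 * finslerLapS Ψ u x

open Filter Topology Asymptotics

namespace IsMinkowskiNorm

variable {n : ℕ} {N : Euc n → ℝ}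

theorem nonneg (hN : IsMinkowskiNorm N) (x : Euc n) : 0 ≤ N x := hN.1 x

theorem map_smul_of_nonneg (hN : IsMinkowskiNorm N) {c : ℝ} (hc : 0 ≤ c) (x : Euc n) :
    N (c • x) = c * N x := by
  rw [hN.2.1, abs_of_nonneg hc]

theorem map_zero (hN : IsMinkowskiNorm N) : N 0 = 0 := by
  simpa using hN.2.1 0 0

theorem midpoint_sq_lt (hN : IsMinkowskiNorm N) {x y : Euc n} (h : x ≠ y) :
    N ((1 / 2 : ℝ) • x + (1 / 2 : ℝ) • y) ^ 2 < (N x ^ 2 + N y ^ 2) / 2 := by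
  have := hN.2.2.2.2 (Set.mem_univ x) (Set.mem_univ y) h
    (by norm_num : (0 : ℝ) < 1 / 2) (by norm_num : (0 : ℝ) < 1 / 2) (by norm_num)
  simp only [smul_eq_mul] at this
  linarith

theorem pos (hN : IsMinkowskiNorm N) {x : Euc n} (hx : x ≠ 0) : 0 < N x := by
  have hne : x ≠ -x := fun h => hx <| by
    have h2 : (2 : ℝ) • x = 0 := by
      rw [two_smul]
      nth_rewrite 2 [h]
      exact add_neg_cancel x
    simpa using h2
  have h := hN.midpoint_sq_lt hne
  have hneg : N (-x) = N x := by simpa using hN.2.1 (-1) x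
  rw [smul_neg, add_neg_cancel, hN.map_zero, hneg] at h
  have := hN.nonneg x
  by_contra h0
  have h0 : N x = 0 := by linarith
  norm_num [h0] at h

theorem continuous (hN : IsMinkowskiNorm N) : Continuous N := by
  have h : Continuous fun x => N x ^ 2 :=
    (ConvexOn.locallyLipschitz hN.2.2.2.convexOn).continuous
  have h' : N = fun x => √(N x ^ 2) := funext fun x => (Real.sqrt_sq (hN.nonneg x)).symm
  rw [h']
  exact h.sqrt

theorem differentiableAt (hN : IsMinkowskiNorm N) {x : Euc n} (hx : x ≠ 0) :
    DifferentiableAt ℝ N x := by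
  have h : DifferentiableAt ℝ (fun x => N x ^ 2) x :=
    (hN.2.2.1.contDiffAt (isOpen_compl_singleton.mem_nhds hx)).differentiableAt (by norm_num)
  have h' : N = fun x => √(N x ^ 2) := funext fun x => (Real.sqrt_sq (hN.nonneg x)).symm
  rw [h']
  exact h.sqrt (pow_ne_zero 2 (hN.pos hx).ne')

theorem exists_norm_le (hN : IsMinkowskiNorm N) : ∃ M, 0 ≤ M ∧ ∀ x, ‖x‖ ≤ M * N x := by
  rcases (Metric.sphere (0 : Euc n) 1).eq_empty_or_nonempty with he | hne
  · refine ⟨0, le_rfl, fun x => ?_⟩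
    rcases eq_or_ne x 0 with rfl | hx
    · simp
    · have : (‖x‖⁻¹ • x) ∈ Metric.sphere (0 : Euc n) 1 := by
        simp [norm_smul, hx]
      simp [he] at this
  · obtain ⟨y, hy, hmin⟩ := (isCompact_sphere (0 : Euc n) 1).exists_isMinOn hne
      hN.continuous.continuousOn
    have hy0 : y ≠ 0 := by
      rintro rfl
      simp at hy
    have hpos := hN.pos hy0
    refine ⟨(N y)⁻¹, (inv_pos.mpr hpos).le, fun x => ?_⟩
    rcases eq_or_ne x 0 with rfl | hx
    · simp [hN.map_zero]
    · have hxn : 0 < ‖x‖ := norm_pos_iff.mpr hx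
      have hs : (‖x‖⁻¹ • x) ∈ Metric.sphere (0 : Euc n) 1 := by simp [norm_smul, hx]
      have h : N y ≤ N (‖x‖⁻¹ • x) := hmin hs
      rw [hN.map_smul_of_nonneg (inv_pos.mpr hxn).le, inv_mul_eq_div, le_div_iff₀ hxn] at h
      rw [inv_mul_eq_div, le_div_iff₀ hpos]
      linarith

theorem isCompact_unit (hN : IsMinkowskiNorm N) : IsCompact {ξ | N ξ = 1} := by
  obtain ⟨M, -, hM⟩ := hN.exists_norm_le
  refine (isCompact_closedBall (0 : Euc n) M).of_isClosed_subset
    (isClosed_singleton.preimage hN.continuous) fun ξ hξ => ?_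
  have h := hM ξ
  rw [show N ξ = 1 from hξ, mul_one] at h
  simpa using h

theorem smul_inv_mem_unit (hN : IsMinkowskiNorm N) {x : Euc n} (hx : x ≠ 0) :
    N ((N x)⁻¹ • x) = 1 := by
  rw [hN.map_smul_of_nonneg (inv_nonneg.mpr (hN.nonneg x)), inv_mul_cancel₀ (hN.pos hx).ne']

/-- The supremum defining the dual norm is attained. -/
theorem exists_maximizer (hN : IsMinkowskiNorm N) (hn : 1 ≤ n) (x : Euc n) :
    ∃ ξ, N ξ = 1 ∧ ⟪x, ξ⟫ = dualNorm N x ∧ ∀ η, N η = 1 → ⟪x, η⟫ ≤ dualNorm N x := by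
  have hne : {ξ | N ξ = 1}.Nonempty := by
    have : Nonempty (Fin n) := ⟨⟨0, hn⟩⟩
    obtain ⟨v, hv⟩ := exists_ne (0 : Euc n)
    exact ⟨_, hN.smul_inv_mem_unit hv⟩
  have hc : ContinuousOn (fun ξ : Euc n => ⟪x, ξ⟫) {ξ | N ξ = 1} := by fun_prop
  have hbdd := hN.isCompact_unit.bddAbove_image hc
  obtain ⟨ξ, hξ, h⟩ := hN.isCompact_unit.exists_sSup_image_eq hne hc
  exact ⟨ξ, hξ, h.symm, fun η hη => le_csSup hbdd ⟨η, hη, rfl⟩⟩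

theorem inner_le (hN : IsMinkowskiNorm N) (hn : 1 ≤ n) (x η : Euc n) :
    ⟪x, η⟫ ≤ N η * dualNorm N x := by
  rcases eq_or_ne η 0 with rfl | hη
  · simp [hN.map_zero]
  · obtain ⟨_, _, _, h⟩ := hN.exists_maximizer hn x
    have := h _ (hN.smul_inv_mem_unit hη)
    rwa [inner_smul_right, inv_mul_eq_div, div_le_iff₀ (hN.pos hη), mul_comm] at this

theorem dualNorm_pos (hN : IsMinkowskiNorm N) (hn : 1 ≤ n) {x : Euc n} (hx : x ≠ 0) :
    0 < dualNorm N x := by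
  have h := hN.inner_le hn x x
  have h1 : 0 < ⟪x, x⟫ := real_inner_self_pos.mpr hx
  exact pos_of_mul_pos_right (h1.trans_le h) (hN.nonneg x)

theorem dualNorm_zero (hN : IsMinkowskiNorm N) (hn : 1 ≤ n) : dualNorm N 0 = 0 := by
  obtain ⟨ξ, _, h, _⟩ := hN.exists_maximizer hn 0
  simpa using h.symm

theorem dualNorm_nonneg (hN : IsMinkowskiNorm N) (hn : 1 ≤ n) (x : Euc n) :
    0 ≤ dualNorm N x := by
  rcases eq_or_ne x 0 with rfl | hx
  · exact (hN.dualNorm_zero hn).ge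
  · exact (hN.dualNorm_pos hn hx).le

theorem maximizer_unique (hN : IsMinkowskiNorm N) (hn : 1 ≤ n) {x ξ η : Euc n} (hx : x ≠ 0)
    (hξ : N ξ = 1) (hη : N η = 1) (hxξ : ⟪x, ξ⟫ = dualNorm N x) (hxη : ⟪x, η⟫ = dualNorm N x) :
    ξ = η := by
  by_contra hne
  have h := hN.midpoint_sq_lt hne
  have h1 := hN.inner_le hn x ((1 / 2 : ℝ) • ξ + (1 / 2 : ℝ) • η)
  rw [inner_add_right, inner_smul_right, inner_smul_right, hxξ, hxη] at h1
  rw [hξ, hη] at h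
  have h2 := hN.nonneg ((1 / 2 : ℝ) • ξ + (1 / 2 : ℝ) • η)
  have h3 := hN.dualNorm_pos hn hx
  have h4 : N ((1 / 2 : ℝ) • ξ + (1 / 2 : ℝ) • η) < 1 := by nlinarith
  nlinarith

/-- Any selection of maximizers in the definition of the dual norm is continuous off the origin. -/
theorem tendsto_maximizer (hN : IsMinkowskiNorm N) (hn : 1 ≤ n) {ξ : Euc n → Euc n}
    (hξ : ∀ x, N (ξ x) = 1) (hξd : ∀ x, ⟪x, ξ x⟫ = dualNorm N x) {x : Euc n} (hx : x ≠ 0) :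
    Tendsto ξ (𝓝 x) (𝓝 (ξ x)) := by
  refine hN.isCompact_unit.tendsto_nhds_of_unique_mapClusterPt (Eventually.of_forall hξ)
    fun η hη hcl => ?_
  obtain ⟨M, hM0, hM⟩ := hN.exists_norm_le
  have hlim : Tendsto (fun y => ⟪x, ξ y⟫) (𝓝 x) (𝓝 (dualNorm N x)) := by
    have hlow : Tendsto (fun y => dualNorm N x - ‖x - y‖ * (M + M)) (𝓝 x) (𝓝 (dualNorm N x)) := by
      have : Continuous fun y : Euc n => dualNorm N x - ‖x - y‖ * (M + M) := by fun_prop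
      simpa using this.tendsto x
    refine tendsto_of_tendsto_of_tendsto_of_le_of_le hlow tendsto_const_nhds (fun y => ?_)
      (fun y => ?_)
    · have h1 := hN.inner_le hn y (ξ x)
      rw [hξ, one_mul, ← hξd y] at h1
      have h2 : ⟪x - y, ξ x - ξ y⟫ ≤ ‖x - y‖ * (M + M) := by
        refine (real_inner_le_norm _ _).trans ?_
        gcongr
        refine (norm_sub_le _ _).trans (add_le_add ?_ ?_)
        · simpa [hξ] using hM (ξ x)
        · simpa [hξ] using hM (ξ y)
      rw [inner_sub_left, inner_sub_right, inner_sub_right, hξd x] at h2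
      dsimp only
      linarith
    · simpa [hξ] using hN.inner_le hn x (ξ y)
  have hcl' : MapClusterPt ⟪x, η⟫ (𝓝 x) (fun y => ⟪x, ξ y⟫) :=
    hcl.tendsto_comp (f := fun ζ => ⟪x, ζ⟫) (Continuous.tendsto (by fun_prop) η)
  have heq : ⟪x, η⟫ = dualNorm N x :=
    eq_of_nhds_neBot (ClusterPt.mono hcl' hlim)
  exact hN.maximizer_unique hn hx hη (hξ x) heq (hξd x)

theorem hasGradientAt_dualNorm (hN : IsMinkowskiNorm N) (hn : 1 ≤ n) {ξ : Euc n → Euc n}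
    (hξ : ∀ x, N (ξ x) = 1) (hξd : ∀ x, ⟪x, ξ x⟫ = dualNorm N x) {x : Euc n} (hx : x ≠ 0) :
    HasGradientAt (dualNorm N) (ξ x) x := by
  rw [hasGradientAt_iff_hasFDerivAt, hasFDerivAt_iff_isLittleO]
  have ht := tendsto_iff_norm_sub_tendsto_zero.mp (hN.tendsto_maximizer hn hξ hξd hx)
  refine isLittleO_iff.mpr fun c hc => ?_
  filter_upwards [ht.eventually (ge_mem_nhds hc)] with y hy
  rw [InnerProductSpace.toDual_apply_apply]
  have h1 := hN.inner_le hn y (ξ x)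
  have h2 := hN.inner_le hn x (ξ y)
  have h3 : ⟪ξ y - ξ x, y - x⟫ ≤ c * ‖y - x‖ :=
    (real_inner_le_norm _ _).trans (by gcongr)
  rw [hξ, one_mul] at h1 h2
  have e : ⟪ξ y - ξ x, y - x⟫ = dualNorm N y - ⟪x, ξ y⟫ - ⟪ξ x, y - x⟫ := by
    rw [inner_sub_left, inner_sub_right, real_inner_comm y, real_inner_comm x, hξd]
  have e' : ⟪ξ x, y - x⟫ = ⟪y, ξ x⟫ - dualNorm N x := by
    rw [inner_sub_right, real_inner_comm y, real_inner_comm x, hξd]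
  rw [Real.norm_eq_abs, abs_le]
  constructor <;> nlinarith [norm_nonneg (y - x)]

/-- The gradient of `N` at a positive multiple of a maximizer for the dual norm at `x`. -/
theorem gradient_of_inner_eq (hN : IsMinkowskiNorm N) (hn : 1 ≤ n) {x η : Euc n} (hη : η ≠ 0)
    (h : ⟪x, η⟫ = N η * dualNorm N x) : dualNorm N x • gradient N η = x := by
  have hd := (hN.differentiableAt hη).hasGradientAt.hasFDerivAt
  have hmin : IsLocalMin (fun ζ => dualNorm N x * N ζ - ⟪x, ζ⟫) η := by
    refine Eventually.of_forall fun ζ => ?_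
    have := hN.inner_le hn x ζ
    dsimp only
    rw [h]
    linarith
  have hd' : HasFDerivAt (fun ζ => dualNorm N x * N ζ - ⟪x, ζ⟫)
      (dualNorm N x • InnerProductSpace.toDual ℝ _ (gradient N η)
        - InnerProductSpace.toDual ℝ _ x) η :=
    (hd.const_mul _).sub (InnerProductSpace.toDual ℝ _ x).hasFDerivAt
  have h0 := hmin.hasFDerivAt_eq_zero hd'
  rw [sub_eq_zero] at h0
  apply (InnerProductSpace.toDual ℝ (Euc n)).injective
  rw [← h0]
  simp

/-- Convex duality: half the gradient `g` of the squared dual norm inverts `N • ∇N`. -/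
theorem exists_dual_gradient (hN : IsMinkowskiNorm N) (hn : 1 ≤ n) :
    ∃ g : Euc n → Euc n, ∀ x,
      HasGradientAt (fun y => dualNorm N y ^ 2) ((2 : ℝ) • g x) x ∧
      ⟪g x, x⟫ = dualNorm N x ^ 2 ∧
      ∀ c : ℝ, 0 ≤ c → N (c • g x) = c * dualNorm N x ∧
        N (c • g x) • gradient N (c • g x) = c • x := by
  choose ξ hξ hξd _ using hN.exists_maximizer hn
  refine ⟨fun x => dualNorm N x • ξ x, fun x => ⟨?_, ?_, fun c hc => ?_⟩⟩
  · rcases eq_or_ne x 0 with rfl | hx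
    · simp only [hN.dualNorm_zero hn, zero_smul, smul_zero]
      rw [hasGradientAt_iff_hasFDerivAt, _root_.map_zero]
      obtain ⟨M, hM0, hM⟩ := hN.exists_norm_le
      refine IsBigO.hasFDerivAt (n := 2) (IsBigO.of_bound (M ^ 2) ?_) (by norm_num)
      refine Eventually.of_forall fun y => ?_
      have h : dualNorm N y ≤ M * ‖y‖ := by
        have h1 := hM (ξ y)
        rw [hξ, mul_one] at h1
        rw [← hξd, mul_comm]
        exact (real_inner_le_norm _ _).trans (by gcongr)
      have h0 := hN.dualNorm_nonneg hn y
      simp only [norm_pow, sub_zero, Real.norm_eq_abs, abs_of_nonneg h0, abs_of_nonneg (norm_nonneg y)]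
      rw [← mul_pow]
      gcongr
    · have h := (hN.hasGradientAt_dualNorm hn hξ hξd hx).hasFDerivAt.pow 2
      rw [hasGradientAt_iff_hasFDerivAt]
      refine h.congr_fderiv ?_
      ext v
      simp [mul_assoc]
  · rw [inner_smul_left, real_inner_comm, hξd, sq]
    simp
  · have hD := hN.dualNorm_nonneg hn x
    have h1 : N (c • dualNorm N x • ξ x) = c * dualNorm N x := by
      rw [hN.map_smul_of_nonneg hc, hN.map_smul_of_nonneg hD, hξ, mul_one]
    refine ⟨h1, ?_⟩
    rw [h1]
    rcases eq_or_ne x 0 with rfl | hx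
    · simp [hN.dualNorm_zero hn]
    rcases eq_or_lt_of_le hc with rfl | hc
    · simp
    have hDp := hN.dualNorm_pos hn hx
    rw [mul_smul, hN.gradient_of_inner_eq hn]
    · intro h0
      rw [h0, hN.map_zero] at h1
      exact (mul_pos hc hDp).ne h1
    · rw [h1, inner_smul_right, inner_smul_right, hξd, mul_assoc]

end IsMinkowskiNorm

theorem divZ_congr {V W : Euc m × Euc k → Euc m} {x : Euc m × Euc k} (h : V =ᶠ[𝓝 x] W) :
    divZ V x = divZ W x := by
  have ht : Tendsto (fun z : Euc m => (z, x.2)) (𝓝 x.1) (𝓝 x) :=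
    Continuous.tendsto (by fun_prop) x.1
  refine Finset.sum_congr rfl fun i _ => ?_
  rw [Filter.EventuallyEq.fderiv_eq ((ht.eventually h).mono fun z hz => congrArg (· i) hz)]

theorem divS_congr {V W : Euc m × Euc k → Euc k} {x : Euc m × Euc k} (h : V =ᶠ[𝓝 x] W) :
    divS V x = divS W x := by
  have ht : Tendsto (fun σ : Euc k => (x.1, σ)) (𝓝 x.2) (𝓝 x) :=
    Continuous.tendsto (by fun_prop) x.2
  refine Finset.sum_congr rfl fun i _ => ?_
  rw [Filter.EventuallyEq.fderiv_eq ((ht.eventually h).mono fun z hz => congrArg (· i) hz)]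

/-- The divergence of `f(x) x` where `f` is differentiable. -/
theorem sum_fderiv_smul_id {n : ℕ} {f : Euc n → ℝ} {f' : Euc n →L[ℝ] ℝ} {x : Euc n}
    (hf : HasFDerivAt f f' x) :
    ∑ i, fderiv ℝ (fun y => (f y • y) i) x (EuclideanSpace.single i 1) = n * f x + f' x := by
  have h (i : Fin n) : fderiv ℝ (fun y => (f y • y) i) x (EuclideanSpace.single i 1)
      = f x + x i * f' (EuclideanSpace.single i 1) := by
    have h1 : HasFDerivAt (fun y : Euc n => (f y • y) i)
        (f x • (EuclideanSpace.proj i : Euc n →L[ℝ] ℝ) + x i • f') x :=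
      hf.mul (EuclideanSpace.proj i : Euc n →L[ℝ] ℝ).hasFDerivAt
    rw [h1.fderiv]
    simp
  have hx : x = ∑ i, x i • EuclideanSpace.single i (1 : ℝ) := by
    simpa using ((EuclideanSpace.basisFun (Fin n) ℝ).sum_repr x).symm
  have hf' : f' x = ∑ i, x i * f' (EuclideanSpace.single i 1) := by
    conv_lhs => rw [hx]
    simp
  rw [Finset.sum_congr rfl fun i _ => h i, Finset.sum_add_distrib, hf']
  simp

/-- The divergence of `f(x) x` at the origin where `f` is continuous and vanishes. -/
theorem sum_fderiv_smul_id_zero {n : ℕ} {f : Euc n → ℝ} (hf : ContinuousAt f 0) (h0 : f 0 = 0) :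
    ∑ i, fderiv ℝ (fun y => (f y • y) i) 0 (EuclideanSpace.single i 1) = 0 := by
  refine Finset.sum_eq_zero fun i _ => ?_
  have h1 : HasFDerivAt (fun y : Euc n => (f y • y) i) (0 : Euc n →L[ℝ] ℝ) 0 := by
    rw [hasFDerivAt_iff_isLittleO]
    refine isLittleO_iff.mpr fun c hc => ?_
    have ht : Tendsto (fun y => ‖f y‖) (𝓝 0) (𝓝 0) := by
      simpa [h0] using hf.norm.tendsto
    filter_upwards [ht.eventually (ge_mem_nhds hc)] with y hy
    have := PiLp.norm_apply_le y i
    simp only [PiLp.smul_apply, smul_eq_mul, PiLp.zero_apply, mul_zero, sub_zero,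
      zero_apply, norm_mul]
    gcongr
  rw [h1.fderiv]
  simp

/-- The common radial factor of the two components of the flux of `log ρ`, in terms of
`s = Φ⁰(z)²` and `t = Ψ⁰(σ)²`. -/
def fluxWeight (α Q s t : ℝ) : ℝ :=
  (s ^ α / (s ^ (α + 1) + 4 * (α + 1) ^ 2 * t)) ^ (Q / 2)

theorem fluxWeight_zero {α Q : ℝ} (hα : 0 < α) (hQ : 0 < Q) (t : ℝ) :
    fluxWeight α Q 0 t = 0 := by
  rw [fluxWeight, Real.zero_rpow hα.ne', zero_div, Real.zero_rpow (by positivity)]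

theorem continuousAt_fluxWeight_zero {α Q t : ℝ} (hα : 0 < α) (hQ : 0 < Q) (ht : 0 < t) :
    ContinuousAt (fun s => fluxWeight α Q s t) 0 := by
  have h1 : ContinuousAt (fun s : ℝ => s ^ α) 0 :=
    Real.continuousAt_rpow_const _ _ (Or.inr hα.le)
  have h2 : ContinuousAt (fun s : ℝ => s ^ (α + 1)) 0 :=
    Real.continuousAt_rpow_const _ _ (Or.inr (by positivity))
  refine ContinuousAt.rpow_const (h1.div (h2.add continuousAt_const) ?_) (Or.inr (by positivity))
  rw [Real.zero_rpow (by positivity)]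
  positivity

theorem hasDerivAt_fluxWeight_left {α Q s t : ℝ} (hs : 0 < s) (ht : 0 ≤ t) :
    HasDerivAt (fun s => fluxWeight α Q s t)
      (fluxWeight α Q s t * (Q / 2) *
        (α / s - (α + 1) * s ^ α / (s ^ (α + 1) + 4 * (α + 1) ^ 2 * t))) s := by
  have hG : 0 < s ^ (α + 1) + 4 * (α + 1) ^ 2 * t := by positivity
  have h1 : HasDerivAt (fun s : ℝ => s ^ α) (α * s ^ (α - 1)) s :=
    Real.hasDerivAt_rpow_const (Or.inl hs.ne')
  have h2 : HasDerivAt (fun s : ℝ => s ^ (α + 1)) ((α + 1) * s ^ (α + 1 - 1)) s :=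
    Real.hasDerivAt_rpow_const (Or.inl hs.ne')
  have hW : 0 < s ^ α / (s ^ (α + 1) + 4 * (α + 1) ^ 2 * t) := by positivity
  refine ((h1.div (h2.add_const _) hG.ne').rpow_const (p := Q / 2) (Or.inl hW.ne')).congr_deriv ?_
  rw [fluxWeight, Pi.div_apply, Real.rpow_sub_one hW.ne', add_sub_cancel_right, Real.rpow_sub_one hs.ne']
  field_simp

theorem hasDerivAt_fluxWeight_right {α Q s t : ℝ} (hs : 0 < s) (ht : 0 ≤ t) :
    HasDerivAt (fun t => fluxWeight α Q s t)
      (fluxWeight α Q s t * (Q / 2) *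
        -(4 * (α + 1) ^ 2 / (s ^ (α + 1) + 4 * (α + 1) ^ 2 * t))) t := by
  have hG : 0 < s ^ (α + 1) + 4 * (α + 1) ^ 2 * t := by positivity
  have h1 : HasDerivAt (fun t : ℝ => s ^ (α + 1) + 4 * (α + 1) ^ 2 * t) (4 * (α + 1) ^ 2 * 1) t :=
    ((hasDerivAt_id t).const_mul _).const_add _
  have hW : 0 < s ^ α / (s ^ (α + 1) + 4 * (α + 1) ^ 2 * t) := by positivity
  refine (((hasDerivAt_const t (s ^ α)).div h1 hG.ne').rpow_const (p := Q / 2)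
    (Or.inl hW.ne')).congr_deriv ?_
  rw [fluxWeight, Pi.div_apply, Real.rpow_sub_one hW.ne']
  field_simp
  ring

theorem rpow_mul_self_eq {w p : ℝ} (hw : 0 ≤ w) (hp : 0 < p) :
    w ^ ((p - 2) / 2) * w = w ^ (p / 2) := by
  rcases hw.eq_or_lt with rfl | hw
  · rw [mul_zero, Real.zero_rpow (by positivity)]
  · rw [← Real.rpow_add_one hw.ne']
    ring_nf

theorem log_rho {α : ℝ} (hα : 0 < α) {Φ : Euc m → ℝ} {Ψ : Euc k → ℝ} (hm : 1 ≤ m)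
    (hΦ : IsMinkowskiNorm Φ) (x : Euc m × Euc k) :
    Real.log (rho α Φ Ψ x) = 1 / (2 * (α + 1)) *
      Real.log ((dualNorm Φ x.1 ^ 2) ^ (α + 1) + 4 * (α + 1) ^ 2 * dualNorm Ψ x.2 ^ 2) := by
  have hD := hΦ.dualNorm_nonneg hm x.1
  have hG : 0 ≤ (dualNorm Φ x.1 ^ 2) ^ (α + 1) + 4 * (α + 1) ^ 2 * dualNorm Ψ x.2 ^ 2 := by
    positivity
  rw [rho, Real.rpow_mul hD, Real.rpow_two]
  rcases hG.eq_or_lt with h | h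
  · rw [← h, Real.zero_rpow (by positivity)]
    simp
  · rw [Real.log_rpow h]

theorem hasGradientAt_log_add_const {n : ℕ} {f : Euc n → ℝ} {v x : Euc n} {c a : ℝ}
    (hf : HasGradientAt f v x) (h : f x + a ≠ 0) :
    HasGradientAt (fun y => c * Real.log (f y + a)) ((c / (f x + a)) • v) x := by
  rw [hasGradientAt_iff_hasFDerivAt] at hf ⊢
  refine (((hf.add_const a).log h).const_mul c).congr_fderiv ?_
  rw [map_smul, smul_smul, div_eq_mul_inv]

theorem HasDerivAt.hasGradientAt_comp {n : ℕ} {φ : ℝ → ℝ} {φ' : ℝ} {f : Euc n → ℝ} {v x : Euc n}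
    (hφ : HasDerivAt φ φ' (f x)) (hf : HasGradientAt f v x) :
    HasGradientAt (fun y => φ (f y)) (φ' • v) x := by
  rw [hasGradientAt_iff_hasFDerivAt] at hf ⊢
  refine (hφ.comp_hasFDerivAt x hf).congr_fderiv ?_
  rw [map_smul]

theorem gaugeBase_pos {α s t : ℝ} (hα : 0 < α) (hs : 0 ≤ s) (ht : 0 ≤ t) (h : 0 < s ∨ 0 < t) :
    0 < s ^ (α + 1) + 4 * (α + 1) ^ 2 * t := by
  rcases h with h | h <;> positivity

section Flux

variable {α : ℝ} {Φ : Euc m → ℝ} {Ψ : Euc k → ℝ} {g : Euc m → Euc m} {h : Euc k → Euc k}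

theorem gradZ_log_rho (hα : 0 < α) (hm : 1 ≤ m) (hΦ : IsMinkowskiNorm Φ)
    (hg : ∀ z, HasGradientAt (fun y => dualNorm Φ y ^ 2) ((2 : ℝ) • g z) z)
    {y : Euc m × Euc k}
    (hy : 0 < (dualNorm Φ y.1 ^ 2) ^ (α + 1) + 4 * (α + 1) ^ 2 * dualNorm Ψ y.2 ^ 2) :
    gradZ (fun y => Real.log (rho α Φ Ψ y)) y =
      ((dualNorm Φ y.1 ^ 2) ^ α /
        ((dualNorm Φ y.1 ^ 2) ^ (α + 1) + 4 * (α + 1) ^ 2 * dualNorm Ψ y.2 ^ 2)) • g y.1 := by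
  have h1 : HasDerivAt (fun s : ℝ => s ^ (α + 1)) _ (dualNorm Φ y.1 ^ 2) :=
    Real.hasDerivAt_rpow_const (Or.inr (by linarith))
  have h2 := hasGradientAt_log_add_const (c := 1 / (2 * (α + 1))) (h1.hasGradientAt_comp (hg y.1))
    hy.ne'
  simp only [gradZ, log_rho hα hm hΦ]
  rw [h2.gradient, smul_smul, smul_smul, add_sub_cancel_right]
  congr 1
  field_simp

theorem gradS_log_rho (hα : 0 < α) (hm : 1 ≤ m) (hΦ : IsMinkowskiNorm Φ)
    (hh : ∀ σ, HasGradientAt (fun y => dualNorm Ψ y ^ 2) ((2 : ℝ) • h σ) σ)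
    {y : Euc m × Euc k}
    (hy : 0 < (dualNorm Φ y.1 ^ 2) ^ (α + 1) + 4 * (α + 1) ^ 2 * dualNorm Ψ y.2 ^ 2) :
    gradS (fun y => Real.log (rho α Φ Ψ y)) y =
      (4 * (α + 1) /
        ((dualNorm Φ y.1 ^ 2) ^ (α + 1) + 4 * (α + 1) ^ 2 * dualNorm Ψ y.2 ^ 2)) • h y.2 := by
  have h1 : HasDerivAt (fun t : ℝ => 4 * (α + 1) ^ 2 * t) (4 * (α + 1) ^ 2 * 1)
      (dualNorm Ψ y.2 ^ 2) := (hasDerivAt_id _).const_mul _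
  rw [add_comm] at hy
  have h2 := hasGradientAt_log_add_const (c := 1 / (2 * (α + 1))) (h1.hasGradientAt_comp (hh y.2))
    hy.ne'
  simp only [gradS, log_rho hα hm hΦ, add_comm ((dualNorm Φ y.1 ^ 2) ^ (α + 1))]
  rw [h2.gradient, smul_smul, smul_smul]
  congr 1
  field_simp

/-- Both components of the flux of `log ρ` are multiples of the position vector. -/
theorem flux_log_rho {Q : ℝ} (hα : 0 < α) (hQ : 0 < Q) (hm : 1 ≤ m) (hk : 1 ≤ k)
    (hΦ : IsMinkowskiNorm Φ) (hΨ : IsMinkowskiNorm Ψ) {y : Euc m × Euc k} (hy : y ≠ 0) :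
    (Φ (gradZ (fun y => Real.log (rho α Φ Ψ y)) y) ^ 2 + dualNorm Φ y.1 ^ (2 * α) / 4 *
          Ψ (gradS (fun y => Real.log (rho α Φ Ψ y)) y) ^ 2) ^ ((Q - 2) / 2) •
        (Φ (gradZ (fun y => Real.log (rho α Φ Ψ y)) y) •
          gradient Φ (gradZ (fun y => Real.log (rho α Φ Ψ y)) y)) =
      fluxWeight α Q (dualNorm Φ y.1 ^ 2) (dualNorm Ψ y.2 ^ 2) • y.1 ∧
    (Φ (gradZ (fun y => Real.log (rho α Φ Ψ y)) y) ^ 2 + dualNorm Φ y.1 ^ (2 * α) / 4 *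
          Ψ (gradS (fun y => Real.log (rho α Φ Ψ y)) y) ^ 2) ^ ((Q - 2) / 2) •
        ((dualNorm Φ y.1 ^ (2 * α) / 4 * Ψ (gradS (fun y => Real.log (rho α Φ Ψ y)) y)) •
          gradient Ψ (gradS (fun y => Real.log (rho α Φ Ψ y)) y)) =
      ((α + 1) * fluxWeight α Q (dualNorm Φ y.1 ^ 2) (dualNorm Ψ y.2 ^ 2)) • y.2 := by
  obtain ⟨g, hg⟩ := hΦ.exists_dual_gradient hm
  obtain ⟨h, hh⟩ := hΨ.exists_dual_gradient hk
  have hD := hΦ.dualNorm_nonneg hm y.1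
  have hE := hΨ.dualNorm_nonneg hk y.2
  have hG := gaugeBase_pos hα (sq_nonneg (dualNorm Φ y.1)) (sq_nonneg (dualNorm Ψ y.2)) <| by
    by_cases h1 : y.1 = 0
    · exact Or.inr (pow_pos (hΨ.dualNorm_pos hk fun h2 => hy (Prod.ext h1 h2)) 2)
    · exact Or.inl (pow_pos (hΦ.dualNorm_pos hm h1) 2)
  rw [gradZ_log_rho hα hm hΦ (fun z => (hg z).1) hG, gradS_log_rho hα hm hΦ (fun σ => (hh σ).1) hG]
  set G := (dualNorm Φ y.1 ^ 2) ^ (α + 1) + 4 * (α + 1) ^ 2 * dualNorm Ψ y.2 ^ 2 with hGdef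
  obtain ⟨hΦ1, hΦ2⟩ := (hg y.1).2.2 ((dualNorm Φ y.1 ^ 2) ^ α / G) (by positivity)
  obtain ⟨hΨ1, hΨ2⟩ := (hh y.2).2.2 (4 * (α + 1) / G) (by positivity)
  have hS : dualNorm Φ y.1 ^ (2 * α) = (dualNorm Φ y.1 ^ 2) ^ α := by
    rw [Real.rpow_mul hD, Real.rpow_two]
  have hW : ((dualNorm Φ y.1 ^ 2) ^ α / G * dualNorm Φ y.1) ^ 2 + (dualNorm Φ y.1 ^ 2) ^ α / 4 *
      (4 * (α + 1) / G * dualNorm Ψ y.2) ^ 2 = (dualNorm Φ y.1 ^ 2) ^ α / G := by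
    have hS1 : (dualNorm Φ y.1 ^ 2) ^ (α + 1) = (dualNorm Φ y.1 ^ 2) ^ α * dualNorm Φ y.1 ^ 2 :=
      Real.rpow_add_one' (sq_nonneg _) (by positivity)
    have hG0 := hG.ne'
    field_simp
    rw [hGdef, hS1]
    ring
  have hWeight := rpow_mul_self_eq (w := (dualNorm Φ y.1 ^ 2) ^ α / G) (by positivity) hQ
  constructor
  · rw [hΦ2, hΦ1, hΨ1, hS, hW, smul_smul, hWeight]
    rfl
  · rw [mul_smul, hΨ2, hΦ1, hΨ1, hS, hW, smul_smul, smul_smul, fluxWeight, ← hGdef, ← hWeight]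
    congr 1
    ring

end Flux

/-- The divergence of `φ(N⁰(x)²) x`. -/
theorem sum_fderiv_dualNorm_smul_id {n : ℕ} {N : Euc n → ℝ} (hN : IsMinkowskiNorm N) (hn : 1 ≤ n)
    {φ : ℝ → ℝ} {φ' : ℝ} {x : Euc n} (hφ : HasDerivAt φ φ' (dualNorm N x ^ 2)) :
    ∑ i, fderiv ℝ (fun y => (φ (dualNorm N y ^ 2) • y) i) x (EuclideanSpace.single i 1) =
      n * φ (dualNorm N x ^ 2) + 2 * dualNorm N x ^ 2 * φ' := by
  obtain ⟨g, hg⟩ := hN.exists_dual_gradient hn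
  rw [sum_fderiv_smul_id (hφ.hasGradientAt_comp (hg x).1).hasFDerivAt,
    InnerProductSpace.toDual_apply_apply, inner_smul_left, inner_smul_left, (hg x).2.1]
  simp only [conj_trivial]
  ring


theorem flux_divergence_cancel {a b α Q s t r F G : ℝ} (hQ : Q = a + (α + 1) * b) (hs : s ≠ 0)
    (hG : G ≠ 0) (hGs : G = r * s + 4 * (α + 1) ^ 2 * t) :
    a * F + 2 * s * (F * (Q / 2) * (α / s - (α + 1) * r / G)) +
      (b * ((α + 1) * F) + 2 * t * ((α + 1) * (F * (Q / 2) * -(4 * (α + 1) ^ 2 / G)))) = 0 := by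
  have h1 : G * G⁻¹ = 1 := mul_inv_cancel₀ hG
  have h2 : s * s⁻¹ = 1 := mul_inv_cancel₀ hs
  simp only [div_eq_mul_inv]
  linear_combination F * Q * (α + 1) * G⁻¹ * hGs - F * Q * (α + 1) * h1 + F * Q * α * h2 - F * hQ

/-- For `Q = m + (α+1)k > 1`, the function `u = log ρ` satisfies `𝓛_{α,Q}(u) = 0` on
`ℝ^N ∖ {0}`. -/
theorem Lop_of_log_rho (m k : ℕ) (hm : 1 ≤ m) (hk : 1 ≤ k)
    (α : ℝ) (hα : 0 < α)
    (Φ : Euc m → ℝ) (Ψ : Euc k → ℝ) (hΦ : IsMinkowskiNorm Φ) (hΨ : IsMinkowskiNorm Ψ)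
    (Q : ℝ) (hQ : Q = (m : ℝ) + (α + 1) * (k : ℝ)) (hQ1 : 1 < Q) :
    ∀ x : Euc m × Euc k, x ≠ 0 →
      Lop α Q Φ Ψ (fun y => Real.log (rho α Φ Ψ y)) x = 0 := by
  intro x hx
  have hQ0 : 0 < Q := by linarith
  have hev : ∀ᶠ y in 𝓝 x, y ≠ 0 := isOpen_ne.mem_nhds hx
  rw [Lop, divZ_congr (hev.mono fun y hy => (flux_log_rho hα hQ0 hm hk hΦ hΨ hy).1),
    divS_congr (hev.mono fun y hy => (flux_log_rho hα hQ0 hm hk hΦ hΨ hy).2)]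
  have ht : 0 ≤ dualNorm Ψ x.2 ^ 2 := sq_nonneg _
  by_cases h1 : x.1 = 0
  · have h2 : 0 < dualNorm Ψ x.2 ^ 2 :=
      pow_pos (hΨ.dualNorm_pos hk fun h2 => hx (Prod.ext h1 h2)) 2
    have hD0 := hΦ.dualNorm_zero hm
    obtain ⟨g, hg⟩ := hΦ.exists_dual_gradient hm
    have hcont : ContinuousAt
        (fun z => fluxWeight α Q (dualNorm Φ z ^ 2) (dualNorm Ψ x.2 ^ 2)) 0 := by
      have hc := continuousAt_fluxWeight_zero hα hQ0 h2
      exact ContinuousAt.comp (f := fun z => dualNorm Φ z ^ 2) (by simpa [hD0] using hc)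
        (hg 0).1.hasFDerivAt.continuousAt
    have hZ := sum_fderiv_smul_id_zero hcont (by simp [hD0, fluxWeight_zero hα hQ0])
    simp only [divZ, divS, h1, hZ]
    simp [hD0, fluxWeight_zero hα hQ0]
  · have hs : 0 < dualNorm Φ x.1 ^ 2 := pow_pos (hΦ.dualNorm_pos hm h1) 2
    have hZ := sum_fderiv_dualNorm_smul_id hΦ hm (hasDerivAt_fluxWeight_left (α := α) (Q := Q) hs ht)
    have hS := sum_fderiv_dualNorm_smul_id hΨ hk
      ((hasDerivAt_fluxWeight_right (α := α) (Q := Q) hs ht).const_mul (α + 1))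
    have hG := gaugeBase_pos hα hs.le ht (Or.inl hs)
    simp only [divZ, divS]
    rw [hZ, hS]
    exact flux_divergence_cancel hQ hs.ne' hG.ne' (by rw [Real.rpow_add_one hs.ne'])
end
end

section
/- Let m, k ≥ 1, N = m + k, α > 0, and 1 < p < ∞ with p ≠ Q, where Q = m + (α+1)k, and assume Q > p. Let R_α(z,σ) = (|z|^{2(α+1)} + 4(α+1)²|σ|²)^{1/(2(α+1))} on ℝ^N = ℝ^m × ℝ^k, set ω_{α,p} = ∫_{{R_α<1}} (|z|/R_α(z,σ))^{αp} dz dσ, σ_{α,p} = Q ω_{α,p}, C_{α,p} = ((p−1)/(Q−p)) σ_{α,p}^{−1/(p−1)}, and Γ_{α,p}(z,σ) = C_{α,p} R_α(z,σ)^{−(Q−p)/(p−1)}. Then for every φ ∈ C_c^∞(ℝ^N): ∫_{ℝ^N} (|∇_z Γ_{α,p}|² + (|z|^{2α}/4)|∇_σ Γ_{α,p}|²)^{(p−2)/2} ( ⟨∇_z Γ_{α,p}, ∇_z φ⟩ + (|z|^{2α}/4)⟨∇_σ Γ_{α,p}, ∇_σ φ⟩ ) dz dσ = φ(0,0); i.e.,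 Γ_{α,p} is a fundamental solution, with pole at the origin, of the Euclidean Baouendi-Grushin p-operator u ↦ div_{(z,σ)}( (|∇_z u|² + (|z|^{2α}/4)|∇_σ u|²)^{(p−2)/2} (∇_z u, (|z|^{2α}/4)∇_σ u) ). -/
open Real MeasureTheory
open scoped RealInnerProductSpace

noncomputable section

variable {m k : ℕ}

/-- The gauge `R_α(z,σ) = (|z|^{2(α+1)} + 4(α+1)²|σ|²)^{1/(2(α+1))}`. -/
def grushinGauge (α : ℝ) (x : Euc m × Euc k) : ℝ :=
  (‖x.1‖ ^ (2 * (α + 1)) + 4 * (α + 1) ^ 2 * ‖x.2‖ ^ 2) ^ (1 / (2 * (α + 1)))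

/-- The anisotropic dilation `(z,σ) ↦ (s z, s^{α+1} σ)`. -/
def grushinDilation (α s : ℝ) (x : Euc m × Euc k) : Euc m × Euc k :=
  (s • x.1, s ^ (α + 1) • x.2)

/-- The derivative of `φ` along the generator `(z, (α+1)σ)` of the anisotropic dilations. -/
def eulerDeriv (α : ℝ) (φ : Euc m × Euc k → ℝ) (x : Euc m × Euc k) : ℝ :=
  fderiv ℝ φ x (x.1, (α + 1) • x.2)

lemma grushinGauge_nonneg (α : ℝ) (x : Euc m × Euc k) : 0 ≤ grushinGauge α x := by
  unfold grushinGauge; positivity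

lemma grushinGauge_base_pos (α : ℝ) {x : Euc m × Euc k} (hx : x.1 ≠ 0) :
    0 < ‖x.1‖ ^ (2 * (α + 1)) + 4 * (α + 1) ^ 2 * ‖x.2‖ ^ 2 := by
  have : 0 < ‖x.1‖ := norm_pos_iff.mpr hx
  positivity

lemma grushinGauge_pos (α : ℝ) {x : Euc m × Euc k} (hx : x.1 ≠ 0) : 0 < grushinGauge α x :=
  rpow_pos_of_pos (grushinGauge_base_pos α hx) _

lemma continuous_grushinGauge {α : ℝ} (hα : 0 < α) :
    Continuous (grushinGauge α : Euc m × Euc k → ℝ) := by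
  unfold grushinGauge
  refine Continuous.rpow_const (Continuous.add (Continuous.rpow_const (by fun_prop) ?_)
    (by fun_prop)) ?_
  · intro x; right; positivity
  · intro x; right; positivity

lemma norm_fst_le_grushinGauge {α : ℝ} (hα : 0 < α) (x : Euc m × Euc k) :
    ‖x.1‖ ≤ grushinGauge α x := by
  unfold grushinGauge
  calc ‖x.1‖ = (‖x.1‖ ^ (2 * (α + 1))) ^ (1 / (2 * (α + 1))) := by
        rw [← rpow_mul (norm_nonneg _), mul_one_div_cancel (by positivity), rpow_one]
    _ ≤ _ := by
        refine rpow_le_rpow (by positivity) ?_ (by positivity)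
        have : 0 ≤ 4 * (α + 1) ^ 2 * ‖x.2‖ ^ 2 := by positivity
        linarith

lemma grushinGauge_rpow {α : ℝ} (hα : 0 < α) (x : Euc m × Euc k) :
    grushinGauge α x ^ (2 * (α + 1)) =
      ‖x.1‖ ^ (2 * (α + 1)) + 4 * (α + 1) ^ 2 * ‖x.2‖ ^ 2 := by
  unfold grushinGauge
  rw [← rpow_mul (by positivity), one_div_mul_cancel (by positivity), rpow_one]

lemma norm_snd_le_one_of_grushinGauge_lt_one {α : ℝ} (hα : 0 < α) {x : Euc m × Euc k}
    (hx : grushinGauge α x < 1) : ‖x.2‖ ≤ 1 := by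
  have h1 : grushinGauge α x ^ (2 * (α + 1)) ≤ 1 :=
    rpow_le_one (grushinGauge_nonneg α x) hx.le (by positivity)
  rw [grushinGauge_rpow hα] at h1
  have h2 : 0 ≤ ‖x.1‖ ^ (2 * (α + 1)) := by positivity
  have h3 : 0 ≤ α * ‖x.2‖ ^ 2 := by positivity
  have h4 : 0 ≤ α ^ 2 * ‖x.2‖ ^ 2 := by positivity
  nlinarith [norm_nonneg x.2]

lemma grushinGauge_dilation {α : ℝ} (hα : 0 < α) {s : ℝ} (hs : 0 < s) (x : Euc m × Euc k) :
    grushinGauge α (grushinDilation α s x) = s * grushinGauge α x := by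
  unfold grushinGauge grushinDilation
  have h1 : (s ^ (α + 1)) ^ 2 = s ^ (2 * (α + 1)) := by
    rw [← rpow_natCast, ← rpow_mul hs.le]; congr 1; push_cast; ring
  have h2 : 0 < s ^ (α + 1) := rpow_pos_of_pos hs _
  simp only [norm_smul, Real.norm_eq_abs, abs_of_pos hs, abs_of_pos h2]
  rw [mul_rpow hs.le (norm_nonneg _), mul_pow, h1,
    show s ^ (2 * (α + 1)) * ‖x.1‖ ^ (2 * (α + 1)) +
      4 * (α + 1) ^ 2 * (s ^ (2 * (α + 1)) * ‖x.2‖ ^ 2) =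
      s ^ (2 * (α + 1)) * (‖x.1‖ ^ (2 * (α + 1)) + 4 * (α + 1) ^ 2 * ‖x.2‖ ^ 2) by ring,
    mul_rpow (by positivity) (by positivity), ← rpow_mul hs.le,
    mul_one_div_cancel (by positivity), rpow_one]

lemma isOpen_grushinGauge_lt {α : ℝ} (hα : 0 < α) (r : ℝ) :
    IsOpen {x : Euc m × Euc k | grushinGauge α x < r} :=
  isOpen_lt (continuous_grushinGauge hα) continuous_const

lemma volume_grushinGauge_lt_one {α : ℝ} (hα : 0 < α) :
    volume {x : Euc m × Euc k | grushinGauge α x < 1} < ⊤ := by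
  refine lt_of_le_of_lt (measure_mono fun x hx => ?_)
    (isCompact_closedBall (0 : Euc m × Euc k) 1).measure_lt_top
  rw [mem_closedBall_zero_iff, Prod.norm_def]
  exact max_le ((norm_fst_le_grushinGauge hα x).trans hx.le)
    (norm_snd_le_one_of_grushinGauge_lt_one hα hx)

lemma ae_fst_ne_zero (hm : 1 ≤ m) : ∀ᵐ x : Euc m × Euc k, x.1 ≠ 0 := by
  have : NeZero m := ⟨by omega⟩
  have h := (Measure.quasiMeasurePreserving_fst (μ := (volume : Measure (Euc m)))
    (ν := (volume : Measure (Euc k)))).ae (p := fun z => z ≠ 0) (by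
      rw [ae_iff]; simp)
  exact h

lemma map_grushinDilation_volume (α : ℝ) {s : ℝ} (hs : 0 < s) :
    Measure.map (grushinDilation α s) (volume : Measure (Euc m × Euc k)) =
      ENNReal.ofReal (s ^ (-((m : ℝ) + (α + 1) * k))) • volume := by
  have h2 : 0 < s ^ (α + 1) := rpow_pos_of_pos hs _
  have h3 : (s ^ m)⁻¹ * ((s ^ (α + 1)) ^ k)⁻¹ = s ^ (-((m : ℝ) + (α + 1) * k)) := by
    rw [← rpow_natCast, ← rpow_natCast, ← rpow_mul hs.le, ← rpow_neg hs.le, ← rpow_neg hs.le,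
      ← rpow_add hs]
    congr 1; ring
  have h : grushinDilation α s = Prod.map (fun z : Euc m => s • z)
      (fun σ : Euc k => s ^ (α + 1) • σ) := rfl
  rw [h, Measure.volume_eq_prod, ← Measure.map_prod_map _ _ (by fun_prop) (by fun_prop),
    Measure.map_addHaar_smul _ hs.ne', Measure.map_addHaar_smul _ h2.ne',
    Measure.prod_smul_left, Measure.prod_smul_right, smul_smul, finrank_euclideanSpace_fin,
    finrank_euclideanSpace_fin, ← ENNReal.ofReal_mul (abs_nonneg _), ← abs_mul, h3,
    abs_of_pos (rpow_pos_of_pos hs _)]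

lemma integral_comp_grushinDilation (α : ℝ) {s : ℝ} (hs : 0 < s) (f : Euc m × Euc k → ℝ) :
    ∫ x, f (grushinDilation α s x) = s ^ (-((m : ℝ) + (α + 1) * k)) * ∫ x, f x := by
  have h2 : 0 < s ^ (α + 1) := rpow_pos_of_pos hs _
  let e : (Euc m × Euc k) ≃ₜ (Euc m × Euc k) :=
    (Homeomorph.smulOfNeZero s hs.ne').prodCongr (Homeomorph.smulOfNeZero (s ^ (α + 1)) h2.ne')
  have h := e.measurableEmbedding.integral_map (μ := volume) f
  have he : (e : Euc m × Euc k → Euc m × Euc k) = grushinDilation α s := rfl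
  rw [he, map_grushinDilation_volume α hs, integral_smul_measure,
    ENNReal.toReal_ofReal (rpow_pos_of_pos hs _).le, smul_eq_mul] at h
  exact h.symm

lemma continuous_uncurry_grushinDilation {α : ℝ} (hα : 0 < α) :
    Continuous (fun p : ℝ × (Euc m × Euc k) => grushinDilation α p.1 p.2) := by
  unfold grushinDilation
  have : Continuous fun p : ℝ × (Euc m × Euc k) => p.1 ^ (α + 1) :=
    Continuous.rpow_const (by fun_prop) (fun _ => Or.inr (by positivity))
  fun_prop

lemma continuous_eulerDeriv (α : ℝ) {φ : Euc m × Euc k → ℝ} (hφ : ContDiff ℝ 1 φ) :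
    Continuous (eulerDeriv α φ) := by
  unfold eulerDeriv
  exact (hφ.continuous_fderiv one_ne_zero).clm_apply (by fun_prop)

lemma hasCompactSupport_eulerDeriv (α : ℝ) {φ : Euc m × Euc k → ℝ} (hφ : HasCompactSupport φ) :
    HasCompactSupport (eulerDeriv α φ) := by
  refine (hφ.fderiv (𝕜 := ℝ)).mono fun x hx => ?_
  contrapose! hx
  simp only [Function.mem_support, not_not] at hx ⊢
  simp [eulerDeriv, hx]

lemma inv_mul_eulerDeriv_grushinDilation (α : ℝ) (φ : Euc m × Euc k → ℝ) {s : ℝ} (hs : 0 < s)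
    (y : Euc m × Euc k) :
    s⁻¹ * eulerDeriv α φ (grushinDilation α s y) =
      fderiv ℝ φ (grushinDilation α s y) (y.1, ((α + 1) * s ^ α) • y.2) := by
  have h : ((grushinDilation α s y).1, (α + 1) • (grushinDilation α s y).2) =
      s • ((y.1, ((α + 1) * s ^ α) • y.2) : Euc m × Euc k) := by
    simp only [grushinDilation, Prod.smul_mk, smul_smul, rpow_add_one hs.ne']
    congr 2; ring
  rw [eulerDeriv, h, map_smul, smul_eq_mul, inv_mul_cancel_left₀ hs.ne']

lemma hasDerivAt_comp_grushinDilation (α : ℝ) {φ : Euc m × Euc k → ℝ} (hφ : ContDiff ℝ 1 φ)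
    {s : ℝ} (hs : 0 < s) (y : Euc m × Euc k) :
    HasDerivAt (fun t => φ (grushinDilation α t y))
      (s⁻¹ * eulerDeriv α φ (grushinDilation α s y)) s := by
  rw [inv_mul_eulerDeriv_grushinDilation α φ hs]
  have h1 : HasDerivAt (fun t : ℝ => grushinDilation α t y)
      (y.1, ((α + 1) * s ^ α) • y.2) s := by
    unfold grushinDilation
    refine HasDerivAt.prodMk ?_ ?_
    · simpa using (hasDerivAt_id s).smul_const y.1
    · have := (hasDerivAt_rpow_const (x := s) (p := α + 1) (Or.inl hs.ne')).smul_const y.2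
      simpa using this
  exact ((hφ.differentiable one_ne_zero _).hasFDerivAt).comp_hasDerivAt s h1

lemma tendsto_comp_grushinDilation_atTop (α : ℝ) {φ : Euc m × Euc k → ℝ}
    (hφc : HasCompactSupport φ) {y : Euc m × Euc k} (hy : y.1 ≠ 0) :
    Filter.Tendsto (fun t => φ (grushinDilation α t y)) Filter.atTop (nhds 0) := by
  obtain ⟨L, hL⟩ := hφc.isCompact.isBounded.exists_norm_le
  refine tendsto_const_nhds.congr' ?_
  have hy' : 0 < ‖y.1‖ := norm_pos_iff.mpr hy
  filter_upwards [Filter.eventually_gt_atTop (L / ‖y.1‖), Filter.eventually_gt_atTop 0]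
    with t ht ht0
  symm
  refine image_eq_zero_of_notMem_tsupport fun hmem => ?_
  have h1 := (norm_fst_le _).trans (hL _ hmem)
  rw [div_lt_iff₀ hy'] at ht
  simp only [grushinDilation, norm_smul, Real.norm_eq_abs, abs_of_pos ht0] at h1
  linarith

lemma exists_bound_inv_mul_eulerDeriv {α : ℝ} (hα : 0 < α) {φ : Euc m × Euc k → ℝ}
    (hφ : ContDiff ℝ 1 φ) (hφc : HasCompactSupport φ) :
    ∃ K : ℝ, ∀ s : ℝ, 0 < s → s ≤ 1 → ∀ y : Euc m × Euc k, grushinGauge α y < 1 →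
      |s⁻¹ * eulerDeriv α φ (grushinDilation α s y)| ≤ K := by
  obtain ⟨M, hM⟩ := (hφ.continuous_fderiv one_ne_zero).bounded_above_of_compact_support
    (hφc.fderiv (𝕜 := ℝ))
  refine ⟨M * (α + 1), fun s hs hs1 y hy => ?_⟩
  rw [inv_mul_eulerDeriv_grushinDilation α φ hs, ← Real.norm_eq_abs]
  have hM0 : 0 ≤ M := (norm_nonneg _).trans (hM 0)
  refine (ContinuousLinearMap.le_of_opNorm_le _ (hM _) _).trans
    (mul_le_mul_of_nonneg_left ?_ hM0)
  rw [Prod.norm_def]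
  refine max_le ?_ ?_
  · have := norm_fst_le_grushinGauge hα y
    simp only
    linarith
  · have h1 : s ^ α ≤ 1 := rpow_le_one hs.le hs1 hα.le
    have h2 : 0 ≤ s ^ α := rpow_nonneg hs.le _
    have h3 := norm_snd_le_one_of_grushinGauge_lt_one hα hy
    simp only [norm_smul, Real.norm_eq_abs]
    rw [abs_of_nonneg (by positivity)]
    have h4 : s ^ α * ‖y.2‖ ≤ 1 := mul_le_one₀ h1 (norm_nonneg _) h3
    nlinarith

/-- For a weight `w` that is invariant under the anisotropic dilations, the distribution
`w R_α^{-Q}` tested against the Euler derivative of `φ` returns the value of `φ` at the origin. -/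
lemma integral_weight_mul_eulerDeriv (hm : 1 ≤ m) {α : ℝ} (hα : 0 < α) {Q : ℝ}
    (hQ : Q = (m : ℝ) + (α + 1) * k) {w : Euc m × Euc k → ℝ} (hw : Measurable w)
    (hw0 : ∀ x, 0 ≤ w x) (hw1 : ∀ x, w x ≤ 1)
    (hwδ : ∀ s : ℝ, 0 < s → ∀ x, w (grushinDilation α s x) = w x)
    {φ : Euc m × Euc k → ℝ} (hφ : ContDiff ℝ 1 φ) (hφc : HasCompactSupport φ) :
    ∫ x, w x * grushinGauge α x ^ (-Q) * eulerDeriv α φ x =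
      -(Q * ∫ x in {x | grushinGauge α x < 1}, w x) * φ (0, 0) := by
  have hQ0 : 0 < Q := by
    have : (1 : ℝ) ≤ m := by exact_mod_cast hm
    rw [hQ]; positivity
  set D := eulerDeriv α φ with hD
  have hDc : Continuous D := continuous_eulerDeriv α hφ
  have hDs : HasCompactSupport D := hasCompactSupport_eulerDeriv α hφc
  have hDi : Integrable D := hDc.integrable_of_hasCompactSupport hDs
  obtain ⟨M, hM⟩ := hDc.bounded_above_of_compact_support hDs
  have hRc : Continuous (grushinGauge α : Euc m × Euc k → ℝ) := continuous_grushinGauge hα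
  have hball : MeasurableSet {x : Euc m × Euc k | grushinGauge α x < 1} :=
    (isOpen_grushinGauge_lt hα 1).measurableSet
  have hfin : volume {x : Euc m × Euc k | grushinGauge α x < 1} ≠ ⊤ :=
    (volume_grushinGauge_lt_one hα).ne
  let F : ℝ → Euc m × Euc k → ℝ := fun s x =>
    if grushinGauge α x < s then s ^ (-Q - 1) * (w x * D x) else 0
  let G : ℝ → Euc m × Euc k → ℝ := fun s y =>
    if grushinGauge α y < 1 then w y * (s⁻¹ * D (grushinDilation α s y)) else 0
  have hFm : Measurable (Function.uncurry F) := by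
    refine Measurable.ite ?_ (by fun_prop) measurable_const
    exact (isOpen_lt (by fun_prop) continuous_fst).measurableSet
  have hGm : Measurable (Function.uncurry G) := by
    have := (hDc.comp (continuous_uncurry_grushinDilation (m := m) (k := k) hα)).measurable
    refine Measurable.ite ?_ ((hw.comp measurable_snd).mul (measurable_fst.inv.mul this))
      measurable_const
    exact (isOpen_lt (by fun_prop) continuous_const).measurableSet
  have hFG : ∀ s : ℝ, 0 < s → ∀ y, F s (grushinDilation α s y) = s ^ (-Q) * G s y := by
    intro s hs y
    have h1 : s * grushinGauge α y < s ↔ grushinGauge α y < 1 := by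
      constructor <;> intro h <;> nlinarith
    simp only [F, G, grushinGauge_dilation hα hs, h1, hwδ s hs, mul_ite, mul_zero]
    rw [rpow_sub_one hs.ne']
    congr 1; ring
  have hintFG : ∀ s : ℝ, 0 < s → ∫ x, F s x = ∫ y, G s y := by
    intro s hs
    have h := integral_comp_grushinDilation α hs (F s)
    simp only [hFG s hs, ← hQ, integral_const_mul] at h
    exact (mul_left_cancel₀ (rpow_pos_of_pos hs _).ne' h).symm
  have hnormFG : ∀ s : ℝ, 0 < s → ∫ x, ‖F s x‖ = ∫ y, ‖G s y‖ := by
    intro s hs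
    have h := integral_comp_grushinDilation α hs (fun x => ‖F s x‖)
    simp only [hFG s hs, ← hQ, norm_mul, integral_const_mul,
      Real.norm_of_nonneg (rpow_pos_of_pos hs (-Q)).le] at h
    exact (mul_left_cancel₀ (rpow_pos_of_pos hs _).ne' h).symm
  have hwD : ∀ x, ‖w x * D x‖ ≤ ‖D x‖ := by
    intro x
    rw [norm_mul, Real.norm_of_nonneg (hw0 x)]
    exact mul_le_of_le_one_left (norm_nonneg _) (hw1 x)
  have hFb : ∀ s : ℝ, 0 < s → ∀ x, ‖F s x‖ ≤ s ^ (-Q - 1) * ‖D x‖ := by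
    intro s hs x
    have h0 := (rpow_pos_of_pos hs (-Q - 1)).le
    simp only [F]
    split_ifs
    · rw [norm_mul, Real.norm_of_nonneg h0]
      exact mul_le_mul_of_nonneg_left (hwD x) h0
    · rw [norm_zero]; positivity
  have hFs : ∀ s : ℝ, 0 < s → Integrable (F s) := fun s hs =>
    (hDi.norm.const_mul (s ^ (-Q - 1))).mono'
      (hFm.comp measurable_prodMk_left).aestronglyMeasurable (.of_forall (hFb s hs))
  have hGind : ∀ (s K : ℝ), (∀ y : Euc m × Euc k, grushinGauge α y < 1 →
        |s⁻¹ * D (grushinDilation α s y)| ≤ K) → ∀ y,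
      ‖G s y‖ ≤ Set.indicator {x | grushinGauge α x < 1} (fun _ => K) y := by
    intro s K hK y
    by_cases hy : grushinGauge α y < 1
    · rw [Set.indicator_of_mem (by exact hy)]
      simp only [G, if_pos hy]
      rw [norm_mul, Real.norm_of_nonneg (hw0 y)]
      exact (mul_le_of_le_one_left (norm_nonneg _) (hw1 y)).trans (hK y hy)
    · rw [Set.indicator_of_notMem (by exact hy)]
      simp [G, if_neg hy]
  have hindi : ∀ K : ℝ, Integrable (Set.indicator {x : Euc m × Euc k | grushinGauge α x < 1}
      (fun _ => K)) := fun K =>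
    (integrable_indicator_iff hball).2 (integrableOn_const hfin)
  have hGs : ∀ s : ℝ, Integrable (G s) := fun s =>
    (hindi (|s⁻¹| * M)).mono' (hGm.comp measurable_prodMk_left).aestronglyMeasurable
      (.of_forall (hGind s _ fun y _ => by
        rw [abs_mul]; exact mul_le_mul_of_nonneg_left (hM _) (abs_nonneg _)))
  have hGn : IntegrableOn (fun s => ∫ y, ‖G s y‖) (Set.Ioi 0) := by
    have hmeas : StronglyMeasurable (fun s => ∫ y, ‖G s y‖) :=
      hGm.norm.stronglyMeasurable.integral_prod_right
    have hn : ∀ s, ‖∫ y, ‖G s y‖‖ = ∫ y, ‖G s y‖ := fun s =>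
      Real.norm_of_nonneg (integral_nonneg fun _ => norm_nonneg _)
    rw [← Set.Ioc_union_Ioi_eq_Ioi zero_le_one]
    refine IntegrableOn.union ?_ ?_
    · obtain ⟨K, hK⟩ := exists_bound_inv_mul_eulerDeriv hα hφ hφc
      refine Integrable.mono' (g := fun _ => ∫ y, Set.indicator
        {x : Euc m × Euc k | grushinGauge α x < 1} (fun _ => K) y)
        (integrableOn_const (by simp)) hmeas.aestronglyMeasurable ?_
      refine (ae_restrict_iff' measurableSet_Ioc).2 (.of_forall fun s hs => ?_)
      rw [hn]
      exact integral_mono (hGs s).norm (hindi K) (hGind s K (hK s hs.1 hs.2))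
    · refine Integrable.mono' (g := fun s => s ^ (-Q - 1) * ∫ x, ‖D x‖)
        ((integrableOn_Ioi_rpow_of_lt (by linarith) one_pos).mul_const _)
        hmeas.aestronglyMeasurable ?_
      refine (ae_restrict_iff' measurableSet_Ioi).2 (.of_forall fun s hs => ?_)
      have hs0 : 0 < s := one_pos.trans hs
      rw [hn, ← hnormFG s hs0, ← integral_const_mul]
      exact integral_mono (hFs s hs0).norm (hDi.norm.const_mul _) (hFb s hs0)
  have hGi : Integrable (Function.uncurry G) ((volume.restrict (Set.Ioi 0)).prod volume) :=
    (integrable_prod_iff hGm.aestronglyMeasurable).2 ⟨.of_forall hGs, hGn⟩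
  have hFi : Integrable (Function.uncurry F) ((volume.restrict (Set.Ioi 0)).prod volume) := by
    refine (integrable_prod_iff hFm.aestronglyMeasurable).2 ⟨?_, ?_⟩
    · exact (ae_restrict_iff' measurableSet_Ioi).2 (.of_forall hFs)
    · exact IntegrableOn.congr_fun hGn (fun s hs => (hnormFG s hs).symm) measurableSet_Ioi
  have hF1 : ∀ᵐ x : Euc m × Euc k, ∫ s in Set.Ioi 0, F s x =
      Q⁻¹ * (w x * grushinGauge α x ^ (-Q) * D x) := by
    filter_upwards [ae_fst_ne_zero hm] with x hx
    have hR := grushinGauge_pos α hx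
    have h1 : ∀ s, F s x = Set.indicator (Set.Ioi (grushinGauge α x))
        (fun s => s ^ (-Q - 1) * (w x * D x)) s := by
      intro s; simp only [F, Set.indicator, Set.mem_Ioi]
    simp only [h1]
    rw [setIntegral_indicator measurableSet_Ioi,
      Set.inter_eq_right.2 (Set.Ioi_subset_Ioi hR.le), integral_mul_const,
      integral_Ioi_rpow_of_lt (by linarith) hR, sub_add_cancel]
    field_simp
  have hG1 : ∀ᵐ y : Euc m × Euc k, ∫ s in Set.Ioi 0, G s y =
      Set.indicator {x | grushinGauge α x < 1} w y * (-φ (0, 0)) := by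
    filter_upwards [ae_fst_ne_zero hm, hGi.prod_left_ae] with y hy hyi
    by_cases hR : grushinGauge α y < 1
    · simp only [G, if_pos hR, Function.uncurry] at hyi ⊢
      rw [Set.indicator_of_mem (by exact hR), integral_const_mul]
      rcases eq_or_ne (w y) 0 with h0 | h0
      · simp [h0]
      · have hi : IntegrableOn (fun s => s⁻¹ * D (grushinDilation α s y)) (Set.Ioi 0) :=
          (integrable_const_mul_iff (IsUnit.mk0 _ h0) _).1 hyi
        have hcont : Continuous fun s => φ (grushinDilation α s y) :=
          hφ.continuous.comp ((continuous_uncurry_grushinDilation hα).comp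
            (continuous_id.prodMk continuous_const))
        rw [integral_Ioi_of_hasDerivAt_of_tendsto hcont.continuousWithinAt
          (fun s hs => hasDerivAt_comp_grushinDilation α hφ hs y) hi
          (tendsto_comp_grushinDilation_atTop α hφc hy)]
        have : grushinDilation α 0 y = (0, 0) := by
          simp [grushinDilation, zero_rpow (by positivity : α + 1 ≠ 0)]
        rw [this, zero_sub]
    · rw [Set.indicator_of_notMem (by exact hR)]
      simp [G, if_neg hR]
  have hswap : ∫ x, ∫ s in Set.Ioi 0, F s x = ∫ y, ∫ s in Set.Ioi 0, G s y := by
    rw [← integral_integral_swap hFi, ← integral_integral_swap hGi]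
    exact setIntegral_congr_fun measurableSet_Ioi fun s hs => hintFG s hs
  rw [integral_congr_ae hF1, integral_congr_ae hG1, integral_const_mul, integral_mul_const,
    integral_indicator hball, inv_mul_eq_iff_eq_mul₀ hQ0.ne'] at hswap
  rw [hswap]; ring

lemma inner_gradZ_eq_fderiv {φ : Euc m × Euc k → ℝ} (hφ : Differentiable ℝ φ)
    (x : Euc m × Euc k) (v : Euc m) : ⟪gradZ φ x, v⟫ = fderiv ℝ φ x (v, 0) := by
  have h : HasFDerivAt (fun z => φ (z, x.2)) _ x.1 :=
    HasFDerivAt.comp x.1 (hφ (x.1, x.2)).hasFDerivAt (hasFDerivAt_prodMk_left x.1 x.2)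
  rw [gradZ, ← InnerProductSpace.toDual_apply_apply (𝕜 := ℝ), toDual_gradient, h.fderiv]
  simp

lemma inner_gradS_eq_fderiv {φ : Euc m × Euc k → ℝ} (hφ : Differentiable ℝ φ)
    (x : Euc m × Euc k) (v : Euc k) : ⟪gradS φ x, v⟫ = fderiv ℝ φ x (0, v) := by
  have h : HasFDerivAt (fun σ => φ (x.1, σ)) _ x.2 :=
    HasFDerivAt.comp x.2 (hφ (x.1, x.2)).hasFDerivAt (hasFDerivAt_prodMk_right x.1 x.2)
  rw [gradS, ← InnerProductSpace.toDual_apply_apply (𝕜 := ℝ), toDual_gradient, h.fderiv]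
  simp

lemma inner_gradZ_add_inner_gradS_eq_eulerDeriv (α : ℝ) {φ : Euc m × Euc k → ℝ}
    (hφ : Differentiable ℝ φ) (x : Euc m × Euc k) :
    ⟪x.1, gradZ φ x⟫ + (α + 1) * ⟪x.2, gradS φ x⟫ = eulerDeriv α φ x := by
  rw [real_inner_comm, real_inner_comm _ x.2, ← real_inner_smul_right,
    inner_gradZ_eq_fderiv hφ, inner_gradS_eq_fderiv hφ, ← map_add, eulerDeriv]
  simp

lemma gradZ_const_mul_grushinGauge_rpow {α : ℝ} (hα : 0 < α) (C β : ℝ) {x : Euc m × Euc k}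
    (hx : x.1 ≠ 0) :
    gradZ (fun y => C * grushinGauge α y ^ (-β)) x =
      (-(C * β * grushinGauge α x ^ (-β - 2 * (α + 1)) * ‖x.1‖ ^ (2 * α))) • x.1 := by
  have hS := grushinGauge_base_pos α hx
  have hα1 : α + 1 ≠ 0 := by positivity
  have h1 : HasFDerivAt (fun z : Euc m => ‖z‖ ^ (2 * (α + 1)) + 4 * (α + 1) ^ 2 * ‖x.2‖ ^ 2)
      _ x.1 := (hasFDerivAt_norm_rpow x.1 (by linarith : 1 < 2 * (α + 1))).add_const _
  have h2 := (h1.rpow_const (p := 1 / (2 * (α + 1)) * (-β)) (Or.inl hS.ne')).const_mul C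
  refine HasGradientAt.gradient (hasGradientAt_iff_hasFDerivAt.2 ?_)
  have hf : (fun z : Euc m => C * grushinGauge α (z, x.2) ^ (-β)) =
      fun z => C * (‖z‖ ^ (2 * (α + 1)) + 4 * (α + 1) ^ 2 * ‖x.2‖ ^ 2) ^
        (1 / (2 * (α + 1)) * (-β)) := by
    ext z
    rw [grushinGauge, ← rpow_mul (by positivity)]
  rw [hf]
  refine h2.congr_fderiv ?_
  ext v
  have he : grushinGauge α x ^ (-β - 2 * (α + 1)) =
      (‖x.1‖ ^ (2 * (α + 1)) + 4 * (α + 1) ^ 2 * ‖x.2‖ ^ 2) ^ (1 / (2 * (α + 1)) * (-β) - 1) := by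
    rw [grushinGauge, ← rpow_mul hS.le]
    congr 1; field_simp
  rw [he, show 2 * α = 2 * (α + 1) - 2 by ring]
  simp only [smul_apply, innerSL_apply_apply, smul_eq_mul,
    InnerProductSpace.toDual_apply_apply, real_inner_smul_left]
  field_simp

lemma gradS_const_mul_grushinGauge_rpow {α : ℝ} (hα : 0 < α) (C β : ℝ) {x : Euc m × Euc k}
    (hx : x.1 ≠ 0) :
    gradS (fun y => C * grushinGauge α y ^ (-β)) x =
      (-(C * β * grushinGauge α x ^ (-β - 2 * (α + 1)) * (4 * (α + 1)))) • x.2 := by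
  have hS := grushinGauge_base_pos α hx
  have hα1 : α + 1 ≠ 0 := by positivity
  have h1 : HasFDerivAt (fun σ : Euc k => ‖x.1‖ ^ (2 * (α + 1)) + 4 * (α + 1) ^ 2 * ‖σ‖ ^ 2)
      _ x.2 := ((hasStrictFDerivAt_norm_sq x.2).hasFDerivAt.const_mul _).const_add _
  have h2 := (h1.rpow_const (p := 1 / (2 * (α + 1)) * (-β)) (Or.inl hS.ne')).const_mul C
  refine HasGradientAt.gradient (hasGradientAt_iff_hasFDerivAt.2 ?_)
  have hf : (fun σ : Euc k => C * grushinGauge α (x.1, σ) ^ (-β)) =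
      fun σ => C * (‖x.1‖ ^ (2 * (α + 1)) + 4 * (α + 1) ^ 2 * ‖σ‖ ^ 2) ^
        (1 / (2 * (α + 1)) * (-β)) := by
    ext σ
    rw [grushinGauge, ← rpow_mul (by positivity)]
  rw [hf]
  refine h2.congr_fderiv ?_
  ext v
  have he : grushinGauge α x ^ (-β - 2 * (α + 1)) =
      (‖x.1‖ ^ (2 * (α + 1)) + 4 * (α + 1) ^ 2 * ‖x.2‖ ^ 2) ^ (1 / (2 * (α + 1)) * (-β) - 1) := by
    rw [grushinGauge, ← rpow_mul hS.le]
    congr 1; field_simp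
  rw [he]
  simp only [smul_apply, innerSL_apply_apply, smul_eq_mul, nsmul_eq_mul,
    InnerProductSpace.toDual_apply_apply, real_inner_smul_left]
  push_cast
  field_simp

/-- Away from `{z = 0}`, the Grushin `p`-flux of `C R_α^{-β}` paired with the gradient of `φ`. -/
lemma grushinFlux_const_mul_gauge_rpow {α : ℝ} (hα : 0 < α) {A C β p Q : ℝ}
    (hA : 0 < A) (hCA : C * β = A) (hβ : β * (p - 1) = Q - p) {φ : Euc m × Euc k → ℝ}
    (hφ : Differentiable ℝ φ) {x : Euc m × Euc k} (hx : x.1 ≠ 0) :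
    (‖gradZ (fun y => C * grushinGauge α y ^ (-β)) x‖ ^ 2 + ‖x.1‖ ^ (2 * α) / 4 *
        ‖gradS (fun y => C * grushinGauge α y ^ (-β)) x‖ ^ 2) ^ ((p - 2) / 2) *
      (⟪gradZ (fun y => C * grushinGauge α y ^ (-β)) x, gradZ φ x⟫ + ‖x.1‖ ^ (2 * α) / 4 *
        ⟪gradS (fun y => C * grushinGauge α y ^ (-β)) x, gradS φ x⟫) =
      -A ^ (p - 1) *
        ((‖x.1‖ / grushinGauge α x) ^ (α * p) * grushinGauge α x ^ (-Q) * eulerDeriv α φ x) := by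
  rw [gradZ_const_mul_grushinGauge_rpow hα C β hx, gradS_const_mul_grushinGauge_rpow hα C β hx,
    hCA, real_inner_smul_left, real_inner_smul_left, norm_smul, norm_smul, mul_pow, mul_pow,
    Real.norm_eq_abs, Real.norm_eq_abs, sq_abs, sq_abs,
    ← inner_gradZ_add_inner_gradS_eq_eulerDeriv α hφ x]
  have hn : 0 < ‖x.1‖ := norm_pos_iff.mpr hx
  have hR := grushinGauge_pos α hx
  have hS := grushinGauge_rpow hα x
  set R := grushinGauge α x
  set n := ‖x.1‖
  have hnn : n ^ (2 * (α + 1)) = n ^ (2 * α) * n ^ 2 := by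
    rw [← rpow_natCast n 2, ← rpow_add hn]; congr 1; push_cast; ring
  have hbase : (-(A * R ^ (-β - 2 * (α + 1)) * n ^ (2 * α))) ^ 2 * n ^ 2 + n ^ (2 * α) / 4 *
      ((-(A * R ^ (-β - 2 * (α + 1)) * (4 * (α + 1)))) ^ 2 * ‖x.2‖ ^ 2) =
      A ^ 2 * (R ^ (-β - 2 * (α + 1))) ^ 2 * n ^ (2 * α) * R ^ (2 * (α + 1)) := by
    rw [hS, hnn]; ring
  have hpow : (A ^ 2 * (R ^ (-β - 2 * (α + 1))) ^ 2 * n ^ (2 * α) * R ^ (2 * (α + 1))) ^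
      ((p - 2) / 2) * (A * R ^ (-β - 2 * (α + 1)) * n ^ (2 * α)) =
      A ^ (p - 1) * ((n / R) ^ (α * p) * R ^ (-Q)) := by
    apply Real.log_injOn_pos (by simp only [Set.mem_Ioi]; positivity)
      (by simp only [Set.mem_Ioi]; positivity)
    have e1 : Real.log (A ^ 2 * (R ^ (-β - 2 * (α + 1))) ^ 2 * n ^ (2 * α) * R ^ (2 * (α + 1))) =
        2 * log A + 2 * ((-β - 2 * (α + 1)) * log R) + 2 * α * log n + 2 * (α + 1) * log R := by
      rw [log_mul (by positivity) (by positivity), log_mul (by positivity) (by positivity),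
        log_mul (by positivity) (by positivity), log_pow, log_pow, log_rpow hR, log_rpow hn,
        log_rpow hR]
      push_cast; ring
    rw [log_mul (by positivity) (by positivity), log_rpow (by positivity), e1,
      log_mul (by positivity) (by positivity), log_mul (by positivity) (by positivity),
      log_mul (by positivity) (by positivity), log_mul (by positivity) (by positivity),
      log_rpow hR, log_rpow hn, log_rpow hA, log_rpow (by positivity), log_rpow hR,
      log_div hn.ne' hR.ne', show Q = β * (p - 1) + p by linarith]
    ring
  rw [hbase]
  linear_combination (-(⟪x.1, gradZ φ x⟫ + (α + 1) * ⟪x.2, gradS φ x⟫)) * hpow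

lemma setIntegral_weight_pos (hm : 1 ≤ m) {α p : ℝ} (hα : 0 < α) (hp : 0 < p) :
    0 < ∫ x : Euc m × Euc k in {x | grushinGauge α x < 1},
      (‖x.1‖ / grushinGauge α x) ^ (α * p) := by
  have hRc : Continuous (grushinGauge α : Euc m × Euc k → ℝ) := continuous_grushinGauge hα
  have hnn : ∀ x : Euc m × Euc k, 0 ≤ (‖x.1‖ / grushinGauge α x) ^ (α * p) := fun x =>
    rpow_nonneg (div_nonneg (norm_nonneg _) (grushinGauge_nonneg α x)) _
  have hwi : IntegrableOn (fun x : Euc m × Euc k => (‖x.1‖ / grushinGauge α x) ^ (α * p))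
      {x | grushinGauge α x < 1} := by
    refine Integrable.mono' (g := fun _ => 1)
      (integrableOn_const (volume_grushinGauge_lt_one hα).ne)
      ?_ (.of_forall fun x => ?_)
    · have := hRc.measurable
      exact Measurable.aestronglyMeasurable (by fun_prop)
    rw [Real.norm_of_nonneg (hnn x)]
    exact rpow_le_one (div_nonneg (norm_nonneg _) (grushinGauge_nonneg α x))
      (div_le_one_of_le₀ (norm_fst_le_grushinGauge hα x) (grushinGauge_nonneg α x))
      (by positivity)
  rw [setIntegral_pos_iff_support_of_nonneg_ae (.of_forall hnn) hwi]
  have hopen := isOpen_grushinGauge_lt (m := m) (k := k) hα 1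
  have h0 : (0 : Euc m × Euc k) ∈ {x : Euc m × Euc k | grushinGauge α x < 1} := by
    have : (1 / (2 * (α + 1))) ≠ 0 := by positivity
    have h' : 2 * (α + 1) ≠ 0 := by positivity
    simp [grushinGauge, zero_rpow h', zero_rpow this, -one_div]
  refine (hopen.measure_pos volume ⟨0, h0⟩).trans_le (measure_mono_ae ?_)
  filter_upwards [ae_fst_ne_zero hm] with x hx hxR
  exact ⟨(rpow_pos_of_pos (div_pos (norm_pos_iff.mpr hx) (grushinGauge_pos α hx)) _).ne', hxR⟩

/-- Euclidean specialisation: `Γ_{α,p} = C_{α,p} R_α^{−(Q−p)/(p−1)}`, with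
`R_α(z,σ) = (|z|^{2(α+1)} + 4(α+1)²|σ|²)^{1/(2(α+1))}`, is a fundamental solution with pole at
the origin of the Baouendi–Grushin `p`-operator
`u ↦ div((|∇_z u|² + (|z|^{2α}/4)|∇_σ u|²)^{(p−2)/2}(∇_z u, (|z|^{2α}/4)∇_σ u))`. -/
theorem fundamental_solution_baouendi_grushin (m k : ℕ) (hm : 1 ≤ m) (hk : 1 ≤ k)
    (α : ℝ) (hα : 0 < α) (p : ℝ) (hp : 1 < p)
    (Q : ℝ) (hQ : Q = (m : ℝ) + (α + 1) * (k : ℝ)) (hpQ : p ≠ Q) (hQp : p < Q)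
    (R : Euc m × Euc k → ℝ)
    (hR : ∀ x : Euc m × Euc k,
      R x = (‖x.1‖ ^ (2 * (α + 1)) + 4 * (α + 1) ^ 2 * ‖x.2‖ ^ 2) ^ (1 / (2 * (α + 1))))
    (ω σap C : ℝ)
    (hω : ω = ∫ x : Euc m × Euc k in {x | R x < 1}, (‖x.1‖ / R x) ^ (α * p))
    (hσ : σap = Q * ω)
    (hC : C = (p - 1) / (Q - p) * σap ^ (-(1 / (p - 1))))
    (Γ : Euc m × Euc k → ℝ)
    (hΓ : ∀ x, Γ x = C * R x ^ (-((Q - p) / (p - 1))))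
    (φ : Euc m × Euc k → ℝ) (hφ : ContDiff ℝ (⊤ : ℕ∞) φ) (hφc : HasCompactSupport φ) :
    ∫ x : Euc m × Euc k,
      (‖gradZ Γ x‖ ^ 2 + ‖x.1‖ ^ (2 * α) / 4 * ‖gradS Γ x‖ ^ 2) ^ ((p - 2) / 2) *
        (⟪gradZ Γ x, gradZ φ x⟫ + ‖x.1‖ ^ (2 * α) / 4 * ⟪gradS Γ x, gradS φ x⟫)
      = φ (0, 0) := by
  have hRg : R = grushinGauge α := funext hR
  have hΓg : Γ = fun y => C * grushinGauge α y ^ (-((Q - p) / (p - 1))) := by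
    rw [← hRg]; exact funext hΓ
  have hRc : Continuous (grushinGauge α : Euc m × Euc k → ℝ) := continuous_grushinGauge hα
  have hp1 : 0 < p - 1 := by linarith
  have hQp' : 0 < Q - p := by linarith
  have hω0 : 0 < ω := by
    rw [hω, hRg]; exact setIntegral_weight_pos hm hα (by linarith)
  have hσ0 : 0 < σap := by rw [hσ]; exact mul_pos (by linarith) hω0
  have hφ1 : ContDiff ℝ 1 φ := hφ.of_le (by exact_mod_cast le_top)
  have hmain := integral_weight_mul_eulerDeriv hm hα hQ
    (w := fun x => (‖x.1‖ / grushinGauge α x) ^ (α * p))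
    (by have := hRc.measurable; fun_prop)
    (fun x => rpow_nonneg (div_nonneg (norm_nonneg _) (grushinGauge_nonneg α x)) _)
    (fun x => rpow_le_one (div_nonneg (norm_nonneg _) (grushinGauge_nonneg α x))
      (div_le_one_of_le₀ (norm_fst_le_grushinGauge hα x) (grushinGauge_nonneg α x))
      (by positivity))
    (fun s hs x => by
      simp only [grushinGauge_dilation hα hs]
      rw [grushinDilation, norm_smul, Real.norm_of_nonneg hs.le,
        mul_div_mul_left _ _ hs.ne']) hφ1 hφc
  have hCA : C * ((Q - p) / (p - 1)) = σap ^ (-(1 / (p - 1))) := by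
    rw [hC]; field_simp
  have hflux := fun (x : Euc m × Euc k) (hx : x.1 ≠ 0) =>
    grushinFlux_const_mul_gauge_rpow hα (rpow_pos_of_pos hσ0 _) hCA
      (div_mul_cancel₀ _ hp1.ne') (hφ1.differentiable one_ne_zero) hx
  rw [hΓg, integral_congr_ae ((ae_fst_ne_zero hm).mono hflux), integral_const_mul, hmain,
    ← rpow_mul hσ0.le, neg_mul (1 / (p - 1)), one_div_mul_cancel hp1.ne', rpow_neg_one, ← hRg, ← hω, ← hσ]
  field_simp
end
end
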